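/- arXiv:2004.11445 — 11 statements merged into one kernel-verified Lean document; each statement's English description precedes it below -/
import Mathlib

section
/- Let V be a finite set, d : V → V → ℝ an arbitrary function, S a subset of V, and δ a real number. Let T ⊆ S with |T| ≥ (4/5)·|S|, and suppose that for every s ∈ T there are at least (9/10)·|S| elements s' ∈ S with d(s,s') ≤ δ. Then the number of ordered pairs (s,s') ∈ S × S with both d(s,s') ≤ δ and d(s',s) ≤ δ is at least (11/50)·|S|². -/
open scoped Classical in
/-- Inclusion-exclusion for a relation and its converse, inside the square of a finite set. -/
theorem two_mul_card_filter_le_card_filter_symm_add_sq {V : Type*} (r : V → V → Prop)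
    (S : Finset V) :
    2 * ((S ×ˢ S).filter fun p : V × V => r p.1 p.2).card
      ≤ ((S ×ˢ S).filter fun p : V × V => r p.1 p.2 ∧ r p.2 p.1).card + S.card ^ 2 := by
  have hswap : ((S ×ˢ S).filter fun p : V × V => r p.2 p.1).card
      = ((S ×ˢ S).filter fun p : V × V => r p.1 p.2).card :=
    Finset.card_bij' (fun p _ => p.swap) (fun p _ => p.swap)
      (by simp +contextual) (by simp +contextual) (by simp) (by simp)
  have hunion : ((S ×ˢ S).filter (fun p : V × V => r p.1 p.2) ∪
      (S ×ˢ S).filter (fun p : V × V => r p.2 p.1)).card ≤ S.card ^ 2 := by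
    rw [sq, ← Finset.card_product]
    exact Finset.card_le_card
      (Finset.union_subset (Finset.filter_subset _ _) (Finset.filter_subset _ _))
  have hincl := Finset.card_union_add_card_inter
    ((S ×ˢ S).filter fun p : V × V => r p.1 p.2) ((S ×ˢ S).filter fun p : V × V => r p.2 p.1)
  rw [← Finset.filter_and] at hincl
  omega

open scoped Classical in
/-- Counting related pairs row by row, keeping only the rows in `T`. -/
theorem card_mul_le_card_filter_product {V : Type*} (r : V → V → Prop) {S T : Finset V}
    (hTS : T ⊆ S) {c : ℝ} (h : ∀ s ∈ T, c ≤ ((S.filter (r s)).card : ℝ)) :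
    T.card * c ≤ (((S ×ˢ S).filter fun p : V × V => r p.1 p.2).card : ℝ) := by
  have hrows : ((S ×ˢ S).filter fun p : V × V => r p.1 p.2).card
      = ∑ s ∈ S, (S.filter (r s)).card := by
    simp only [Finset.card_filter, Finset.sum_product]
  rw [hrows, Nat.cast_sum, ← nsmul_eq_mul]
  exact (Finset.card_nsmul_le_sum T _ c h).trans
    (Finset.sum_le_sum_of_subset_of_nonneg hTS fun _ _ _ => Nat.cast_nonneg _)

open scoped Classical in
theorem stmt_1 {V : Type*} [Fintype V] (d : V → V → ℝ) (S T : Finset V) (δ : ℝ)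
    (hTS : T ⊆ S)
    (hT : (4 / 5 : ℝ) * S.card ≤ T.card)
    (h : ∀ s ∈ T, (9 / 10 : ℝ) * S.card ≤ ((S.filter fun s' => d s s' ≤ δ).card : ℝ)) :
    (11 / 50 : ℝ) * (S.card : ℝ) ^ 2
      ≤ (((S ×ˢ S).filter fun p : V × V => d p.1 p.2 ≤ δ ∧ d p.2 p.1 ≤ δ).card : ℝ) := by
  have hclose := card_mul_le_card_filter_product (fun s s' => d s s' ≤ δ) hTS h
  have hsymm : (2 : ℝ) * ((S ×ˢ S).filter fun p : V × V => d p.1 p.2 ≤ δ).card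
      ≤ ((S ×ˢ S).filter fun p : V × V => d p.1 p.2 ≤ δ ∧ d p.2 p.1 ≤ δ).card
        + (S.card : ℝ) ^ 2 := by
    exact_mod_cast two_mul_card_filter_le_card_filter_symm_add_sq (fun s s' => d s s' ≤ δ) S
  have hmul := mul_le_mul_of_nonneg_right hT
    (by positivity : (0 : ℝ) ≤ 9 / 10 * S.card)
  nlinarith [sq_nonneg (S.card : ℝ)]
end

section
/- Let V be a finite set, d : V → V → ℝ a function, S a nonempty subset of V, δ ∈ ℝ, and r a natural number. Suppose that for every s ∈ S the number of elements v ∈ V with d(s,v) ≤ δ and d(v,s) ≤ δ is at most (1/5)·|S|. Let R_1, …, R_r be r independent uniformly distributed samples from S and define the random set S' = { s ∈ S : d(s, R_i) ≤ δ for all i = 1, …, r }. Then the probability that |S'| > (4/5)·|S| is at most |S| · (9/10)^r. -/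
open scoped ENNReal

/-- If every element has few two-way neighbours, the average out-degree within `S` is at most
`(1 + 1 / 5) / 2` times the size of `S`. -/
theorem sum_card_filter_le_of_bidirectional {V : Type*} (p : V → V → Prop) [DecidableRel p]
    (S : Finset V) (h : ∀ s ∈ S, ((S.filter fun v => p s v ∧ p v s).card : ℝ) ≤ 1 / 5 * S.card) :
    ∑ s ∈ S, ((S.filter fun v => p s v).card : ℝ) ≤ 3 / 5 * (S.card : ℝ) ^ 2 := by
  have hswap : ∑ s ∈ S, ((S.filter fun v => p v s).card : ℝ)
      = ∑ s ∈ S, ((S.filter fun v => p s v).card : ℝ) := by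
    simp only [Finset.card_filter, Nat.cast_sum]
    exact Finset.sum_comm
  have hle : ∑ s ∈ S, (((S.filter fun v => p s v).card : ℝ) + (S.filter fun v => p v s).card)
      ≤ ∑ _s ∈ S, (6 / 5 * (S.card : ℝ)) := by
    refine Finset.sum_le_sum fun s hs => ?_
    classical
    have hcard := Finset.card_union_add_card_inter
      (S.filter fun v => p s v) (S.filter fun v => p v s)
    rw [← Finset.filter_or, ← Finset.filter_and] at hcard
    have hor : ((S.filter fun v => p s v ∨ p v s).card : ℝ) ≤ S.card := by
      exact_mod_cast Finset.card_filter_le _ _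
    have hcast := congrArg (Nat.cast (R := ℝ)) hcard
    push_cast at hcast
    linarith [h s hs]
  rw [Finset.sum_add_distrib, hswap, Finset.sum_const, nsmul_eq_mul] at hle
  linarith

/-- A subset of more than `4 / 5` of `S` contains an element of out-degree at most
`(9 / 10) * |S|`. -/
theorem exists_card_filter_le_of_bidirectional {V : Type*} (p : V → V → Prop) [DecidableRel p]
    (S T : Finset V) (hT : T ⊆ S) (hcard : (4 / 5 : ℝ) * S.card < T.card)
    (h : ∀ s ∈ S, ((S.filter fun v => p s v ∧ p v s).card : ℝ) ≤ 1 / 5 * S.card) :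
    ∃ s ∈ T, ((S.filter fun v => p s v).card : ℝ) ≤ 9 / 10 * S.card := by
  by_contra! hc
  have hlow : ∑ _s ∈ T, (9 / 10 * (S.card : ℝ)) ≤ ∑ s ∈ T, ((S.filter fun v => p s v).card : ℝ) :=
    Finset.sum_le_sum fun s hs => (hc s hs).le
  have hsub : ∑ s ∈ T, ((S.filter fun v => p s v).card : ℝ)
      ≤ ∑ s ∈ S, ((S.filter fun v => p s v).card : ℝ) :=
    Finset.sum_le_sum_of_subset_of_nonneg hT fun _ _ _ => Nat.cast_nonneg _
  have hup := sum_card_filter_le_of_bidirectional p S h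
  rw [Finset.sum_const, nsmul_eq_mul] at hlow
  have hTS : (T.card : ℝ) ≤ S.card := by exact_mod_cast Finset.card_le_card hT
  have hpos : 0 < (S.card : ℝ) := by
    have := Nat.cast_nonneg (α := ℝ) S.card
    linarith
  nlinarith

/-- The probability that all of `r` independent uniform samples from `S` satisfy `q`. -/
theorem toOuterMeasure_uniformOfFinset_piFinset_forall {V : Type*} (S : Finset V)
    (hS : S.Nonempty) (r : ℕ) (q : V → Prop) [DecidablePred q] :
    (PMF.uniformOfFinset (Fintype.piFinset fun _ : Fin r => S)
        (Fintype.piFinset_nonempty.mpr fun _ => hS)).toOuterMeasure {R | ∀ i, q (R i)}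
      = (((S.filter q).card : ℝ≥0∞) / S.card) ^ r := by
  rw [PMF.toOuterMeasure_uniformOfFinset_apply]
  have hfilter (inst : DecidablePred (· ∈ {R : Fin r → V | ∀ i, q (R i)})) :
      @Finset.filter _ (· ∈ {R | ∀ i, q (R i)}) inst (Fintype.piFinset fun _ => S)
        = Fintype.piFinset fun _ => S.filter q := by
    ext R
    simp [Fintype.mem_piFinset, forall_and]
  rw [hfilter, Fintype.card_piFinset_const, Fintype.card_piFinset_const, Nat.cast_pow,
    Nat.cast_pow, div_eq_mul_inv, div_eq_mul_inv, mul_pow, ENNReal.inv_pow]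

open scoped Classical ENNReal in
theorem stmt_3 {V : Type*} [Fintype V] [DecidableEq V] (d : V → V → ℝ) (S : Finset V)
    (hS : S.Nonempty) (δ : ℝ) (r : ℕ)
    (h : ∀ s ∈ S,
      ((Finset.univ.filter fun v : V => d s v ≤ δ ∧ d v s ≤ δ).card : ℝ)
        ≤ (1 / 5 : ℝ) * S.card) :
    (PMF.uniformOfFinset (Fintype.piFinset fun _ : Fin r => S)
        (Fintype.piFinset_nonempty.mpr fun _ => hS)).toOuterMeasure
        {R : Fin r → V |
          (4 / 5 : ℝ) * S.card < ((S.filter fun s => ∀ i : Fin r, d s (R i) ≤ δ).card : ℝ)}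
      ≤ (S.card : ℝ≥0∞) * (9 / 10 : ℝ≥0∞) ^ r := by
  have hS' : ∀ s ∈ S, ((S.filter fun v => d s v ≤ δ ∧ d v s ≤ δ).card : ℝ) ≤ 1 / 5 * S.card := by
    intro s hs
    refine le_trans ?_ (h s hs)
    exact_mod_cast Finset.card_le_card (Finset.filter_subset_filter _ (Finset.subset_univ S))
  let L := S.filter fun s => ((S.filter fun v => d s v ≤ δ).card : ℝ) ≤ 9 / 10 * S.card
  have hcover : {R : Fin r → V |
      (4 / 5 : ℝ) * S.card < ((S.filter fun s => ∀ i : Fin r, d s (R i) ≤ δ).card : ℝ)}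
      ⊆ ⋃ s ∈ L, {R : Fin r → V | ∀ i, d s (R i) ≤ δ} := by
    intro R hR
    obtain ⟨s, hs, hle⟩ := exists_card_filter_le_of_bidirectional (fun s v => d s v ≤ δ) S _
      (Finset.filter_subset _ S) hR hS'
    rw [Finset.mem_filter] at hs
    simp only [Set.mem_iUnion]
    exact ⟨s, Finset.mem_filter.mpr ⟨hs.1, hle⟩, hs.2⟩
  refine (MeasureTheory.measure_mono hcover).trans
    ((MeasureTheory.measure_biUnion_finset_le L _).trans ?_)
  calc _ ≤ ∑ _s ∈ L, (9 / 10 : ℝ≥0∞) ^ r := by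
        refine Finset.sum_le_sum fun s hs => ?_
        rw [toOuterMeasure_uniformOfFinset_piFinset_forall S hS r fun v => d s v ≤ δ]
        refine pow_le_pow_left₀ zero_le (ENNReal.div_le_of_le_mul ?_) r
        have hle := ENNReal.ofReal_le_ofReal (Finset.mem_filter.mp hs).2
        rwa [ENNReal.ofReal_mul (by norm_num), ENNReal.ofReal_natCast, ENNReal.ofReal_natCast,
          ENNReal.ofReal_div_of_pos (by norm_num), ENNReal.ofReal_ofNat,
          ENNReal.ofReal_ofNat] at hle
    _ = (L.card : ℝ≥0∞) * (9 / 10 : ℝ≥0∞) ^ r := by rw [Finset.sum_const, nsmul_eq_mul]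
    _ ≤ _ := by
        gcongr
        exact Finset.filter_subset _ S
end

section
/- For all integers q ≥ 2 and L ≥ 1 there exist a finite set T with |T| ≤ 3L, an element r ∈ T (the root), and a function p : T → T (the parent map) such that: p(r) = r; for every t ∈ T some iterate p^k(t) equals r; every t ∈ T has at most q children, where the children of t are those s ∈ T with s ≠ r and p(s) = t; exactly L elements of T are leaves, i.e. have no children; and for every leaf t the least k with p^k(t) = r equals ⌈log_q L⌉ (the least natural number d with L ≤ q^d). -/
/-- The nodes `⟨i, a⟩` of the truncated `q`-ary tree: at height `i ≤ d` above the leaf level the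
nodes are numbered by the `a` with `a * q ^ i ≤ n`. -/
def levelNodes (q n d : ℕ) : Finset (Σ _ : ℕ, ℕ) :=
  (Finset.range (d + 1)).sigma fun i => Finset.range (n / q ^ i + 1)

theorem mem_levelNodes {q n d : ℕ} (hq : 0 < q) {x : Σ _ : ℕ, ℕ} :
    x ∈ levelNodes q n d ↔ x.1 ≤ d ∧ x.2 * q ^ x.1 ≤ n := by
  simp [levelNodes, Nat.le_div_iff_mul_le (pow_pos hq _)]

theorem card_levelNodes_le {q : ℕ} (hq : 2 ≤ q) (n d : ℕ) :
    (levelNodes q n d).card ≤ 2 * n + d + 1 := by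
  have h := Nat.geom_sum_Ico_le hq n (d + 1)
  have h' : n / (q - 1) ≤ n := Nat.div_le_self _ _
  have h0 : ∑ i ∈ Finset.range (d + 1), n / q ^ i = n + ∑ i ∈ Finset.Ico 1 (d + 1), n / q ^ i := by
    rw [Finset.range_eq_Ico, Finset.sum_eq_sum_Ico_succ_bot (Nat.succ_pos d)]
    simp
  simp only [levelNodes, Finset.card_sigma, Finset.card_range, Finset.sum_add_distrib,
    Finset.sum_const, smul_eq_mul, mul_one, h0]
  omega

theorem parent_mem_levelNodes {q n d i a : ℕ} (hq : 0 < q) (h : ⟨i, a⟩ ∈ levelNodes q n d)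
    (hi : i ≠ d) : ⟨i + 1, a / q⟩ ∈ levelNodes q n d := by
  rw [mem_levelNodes hq] at h ⊢
  refine ⟨by dsimp at h ⊢; omega, le_trans ?_ h.2⟩
  dsimp
  rw [pow_succ', ← mul_assoc]
  exact Nat.mul_le_mul_right _ (Nat.div_mul_le_self a q)

/-- The parent map of the truncated `q`-ary tree, fixing the nodes at height `d`. -/
def levelParent (q n d : ℕ) (hq : 0 < q) (x : levelNodes q n d) : levelNodes q n d :=
  if h : x.1.1 = d then x else ⟨⟨x.1.1 + 1, x.1.2 / q⟩, parent_mem_levelNodes hq x.2 h⟩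

theorem height_iterate_levelParent {q n d : ℕ} (hq : 0 < q) (k : ℕ) (x : levelNodes q n d) :
    ((levelParent q n d hq)^[k] x).1.1 = min d (x.1.1 + k) := by
  induction k generalizing x with
  | zero => simpa using ((mem_levelNodes hq).1 x.2).1
  | succ k ih =>
    rw [Function.iterate_succ_apply, ih]
    have := ((mem_levelNodes hq).1 x.2).1
    unfold levelParent
    split_ifs with h
    · omega
    · dsimp
      omega

open scoped Classical in
theorem stmt_4 (q L : ℕ) (hq : 2 ≤ q) (hL : 1 ≤ L) :
    ∃ (T : Type) (_ : Fintype T) (r : T) (p : T → T),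
      Fintype.card T ≤ 3 * L ∧
      p r = r ∧
      (∀ t : T, ∃ k : ℕ, p^[k] t = r) ∧
      (∀ t : T, (Finset.univ.filter fun s : T => s ≠ r ∧ p s = t).card ≤ q) ∧
      (Finset.univ.filter fun t : T => ∀ s : T, ¬(s ≠ r ∧ p s = t)).card = L ∧
      (∀ t : T, (∀ s : T, ¬(s ≠ r ∧ p s = t)) →
        sInf {k : ℕ | p^[k] t = r} = Nat.clog q L) := by
  have hq0 : 0 < q := by omega
  set d := Nat.clog q L
  have hLd : L ≤ q ^ d := Nat.le_pow_clog (by omega) L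
  have hdL : d ≤ L := Nat.clog_le_of_le_pow (Nat.lt_pow_self (by omega)).le
  let r : levelNodes q (L - 1) d := ⟨⟨d, 0⟩, (mem_levelNodes hq0).2 (by simp)⟩
  let p := levelParent q (L - 1) d hq0
  have hr (x : levelNodes q (L - 1) d) : x = r ↔ x.1.1 = d := by
    refine ⟨fun h => h ▸ rfl, fun h => ?_⟩
    obtain ⟨⟨i, a⟩, hx⟩ := x
    obtain rfl : i = d := h
    have h2 := ((mem_levelNodes hq0).1 hx).2
    dsimp at h2
    obtain rfl : a = 0 := by
      by_contra ha
      have := Nat.le_mul_of_pos_left (q ^ d) (Nat.pos_of_ne_zero ha)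
      omega
    rfl
  have hiter (k : ℕ) (x : levelNodes q (L - 1) d) : p^[k] x = r ↔ d ≤ x.1.1 + k := by
    rw [hr, height_iterate_levelParent]
    omega
  have hp (x : levelNodes q (L - 1) d) (hx : x ≠ r) :
      (p x).1 = ⟨x.1.1 + 1, x.1.2 / q⟩ := by
    simp only [p, levelParent, dif_neg (mt (hr x).2 hx)]
  have hleaf (t : levelNodes q (L - 1) d) : (∀ s, ¬(s ≠ r ∧ p s = t)) ↔ t.1.1 = 0 := by
    constructor
    · intro h
      by_contra ht
      obtain ⟨⟨i, a⟩, hx⟩ := t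
      obtain ⟨i, rfl⟩ := Nat.exists_eq_succ_of_ne_zero ht
      have hx' := (mem_levelNodes hq0).1 hx
      dsimp at hx'
      have hs : ⟨i, a * q⟩ ∈ levelNodes q (L - 1) d :=
        (mem_levelNodes hq0).2 ⟨by dsimp; omega, by
          dsimp
          rw [mul_assoc, ← pow_succ']
          exact hx'.2⟩
      have hsr : (⟨_, hs⟩ : levelNodes q (L - 1) d) ≠ r := by
        rw [Ne, hr]
        dsimp
        omega
      refine h ⟨_, hs⟩ ⟨hsr, Subtype.ext ?_⟩
      rw [hp _ hsr]
      simp [Nat.mul_div_cancel _ hq0]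
    · rintro h s ⟨hs, rfl⟩
      rw [hp s hs] at h
      simp at h
  refine ⟨levelNodes q (L - 1) d, inferInstance, r, p, ?_, ?_, ?_, ?_, ?_, ?_⟩
  · have := card_levelNodes_le hq (L - 1) d
    rw [Fintype.card_coe]
    omega
  · exact (hiter 1 r).2 (Nat.le_succ d)
  · exact fun t => ⟨d, (hiter d t).2 (Nat.le_add_left _ _)⟩
  · intro t
    conv_rhs => rw [← Finset.card_range q]
    refine Finset.card_le_card_of_injOn (fun s => s.1.2 % q)
      (fun s _ => by simpa using Nat.mod_lt _ hq0) ?_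
    intro s hs s' hs' h
    simp only [Finset.coe_filter, Finset.mem_univ, true_and, Set.mem_ofPred_eq] at hs hs'
    have e : (p s).1 = (p s').1 := by rw [hs.2, hs'.2]
    rw [hp s hs.1, hp s' hs'.1] at e
    simp only [Sigma.mk.injEq, heq_eq_eq] at e
    refine Subtype.ext (Sigma.ext (by omega) (heq_of_eq ?_))
    rw [← Nat.div_add_mod s.1.2 q, ← Nat.div_add_mod s'.1.2 q, e.2]
    exact congrArg _ h
  · simp only [hleaf]
    conv_rhs => rw [← Finset.card_range L]
    refine Finset.card_bij (fun s _ => s.1.2) ?_ ?_ ?_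
    · intro s hs
      have h := ((mem_levelNodes hq0).1 s.2).2
      rw [(Finset.mem_filter.1 hs).2, pow_zero, mul_one] at h
      rw [Finset.mem_range]
      omega
    · intro s hs s' hs' h
      exact Subtype.ext (Sigma.ext
        ((Finset.mem_filter.1 hs).2.trans (Finset.mem_filter.1 hs').2.symm) (heq_of_eq h))
    · intro a ha
      rw [Finset.mem_range] at ha
      exact ⟨⟨⟨0, a⟩, (mem_levelNodes hq0).2 ⟨Nat.zero_le _, by simp; omega⟩⟩, by simp, rfl⟩
  · intro t ht
    rw [hleaf] at ht
    simp only [hiter, ht, zero_add]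
    exact csInf_Ici
end

section
/- Let G be a directed graph on a finite vertex set V with |V| = n ≥ 2 and with m ≥ 1 edges, and set q = max(2, ⌈m/n⌉) and t = ⌈log_q n⌉. Then there exists a directed graph G' on a finite vertex set V' with V ⊆ V' and |V'| ≤ n·(⌈log₂ n⌉ + 7), such that every vertex of G' has out-degree at most q, for all u, v ∈ V the distance in G' satisfies d_{G'}(u,v) = t · d_G(u,v) (in ℕ∞, with t·∞ = ∞), and the girth of G' equals t times the girth of G. -/
/-- A walk of length `L` from `u` to `v` in the digraph with adjacency `Adj`. -/
def IsWalk {V : Type*} (Adj : V → V → Prop) (L : ℕ) (w : ℕ → V) (u v : V) : Prop :=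
  w 0 = u ∧ w L = v ∧ ∀ i < L, Adj (w i) (w (i + 1))

/-- A cycle of length `L ≥ 1` based at `u`: a closed walk whose first `L` vertices
are pairwise distinct. -/
def IsCycle {V : Type*} (Adj : V → V → Prop) (L : ℕ) (w : ℕ → V) (u : V) : Prop :=
  IsWalk Adj L w u u ∧ 1 ≤ L ∧ ∀ i < L, ∀ j < L, w i = w j → i = j

/-- The directed distance in `ℕ∞`: the minimum length of a walk from `u` to `v`. -/
noncomputable def ddist {V : Type*} (Adj : V → V → Prop) (u v : V) : ℕ∞ :=
  sInf {x : ℕ∞ | ∃ L : ℕ, x = L ∧ ∃ w : ℕ → V, IsWalk Adj L w u v}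

/-- The girth in `ℕ∞`: the minimum length of a cycle. -/
noncomputable def digirth {V : Type*} (Adj : V → V → Prop) : ℕ∞ :=
  sInf {x : ℕ∞ | ∃ L : ℕ, x = L ∧ ∃ (w : ℕ → V) (u : V), IsCycle Adj L w u}

section Walks

variable {V : Type*} {Adj : V → V → Prop}

theorem IsWalk.append {K L : ℕ} {w w' : ℕ → V} {u v x : V}
    (h : IsWalk Adj K w u v) (h' : IsWalk Adj L w' v x) :
    IsWalk Adj (K + L) (fun i => if i < K then w i else w' (i - K)) u x := by
  obtain ⟨h0, hK, hs⟩ := h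
  obtain ⟨h0', hL', hs'⟩ := h'
  refine ⟨?_, ?_, fun i hi => ?_⟩
  · rcases Nat.eq_zero_or_pos K with rfl | hK0
    · simp [h0', ← hK, h0]
    · simp [hK0, h0]
  · simp [hL']
  · rcases lt_trichotomy (i + 1) K with h | h | h
    · simpa [h, (by omega : i < K)] using hs i (by omega)
    · have := hs i (by omega)
      simpa [h, (by omega : i < K), h0', hK] using this
    · have := hs' (i - K) (by omega)
      rw [show i - K + 1 = i + 1 - K by omega] at this
      dsimp only
      rwa [if_neg (by omega), if_neg (by omega)]

/-- Every closed walk of positive length contains a cycle. -/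
theorem IsWalk.exists_isCycle {L : ℕ} {w : ℕ → V} {u : V} (h : IsWalk Adj L w u u)
    (hL : 1 ≤ L) : ∃ K ≤ L, ∃ (w' : ℕ → V) (v : V), IsCycle Adj K w' v := by
  induction L using Nat.strong_induction_on generalizing w u with
  | _ L ih =>
    by_cases hinj : ∀ i < L, ∀ j < L, w i = w j → i = j
    · exact ⟨L, le_rfl, w, u, h, hL, hinj⟩
    · have : ∃ i j, i < j ∧ j < L ∧ w i = w j := by
        push Not at hinj
        obtain ⟨i, hi, j, hj, hw, hne⟩ := hinj
        rcases lt_or_gt_of_ne hne with h | h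
        · exact ⟨i, j, h, hj, hw⟩
        · exact ⟨j, i, h, hi, hw.symm⟩
      obtain ⟨i, j, hij, hj, hw⟩ := this
      have hsub : IsWalk Adj (j - i) (fun k => w (i + k)) (w i) (w i) := by
        refine ⟨rfl, ?_, fun k hk => h.2.2 (i + k) (by omega)⟩
        simp [Nat.add_sub_cancel' hij.le, hw]
      obtain ⟨K, hK, hc⟩ := ih (j - i) (by omega) hsub (by omega)
      exact ⟨K, by omega, hc⟩

end Walks

theorem sInf_natCast_eq_mul {A B : ℕ → Prop} {t : ℕ} (ht : t ≠ 0)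
    (hAB : ∀ k, A k → ∃ L ≤ t * k, B L) (hBA : ∀ L, B L → ∃ k, t * k ≤ L ∧ A k) :
    sInf {x : ℕ∞ | ∃ L : ℕ, x = L ∧ B L} = t * sInf {x : ℕ∞ | ∃ k : ℕ, x = k ∧ A k} := by
  apply le_antisymm
  · rcases Set.eq_empty_or_nonempty {x : ℕ∞ | ∃ k : ℕ, x = k ∧ A k} with h | h
    · rw [h, sInf_empty, ENat.mul_top (by exact_mod_cast ht)]
      exact le_top
    · obtain ⟨k, hk, hAk⟩ : ∃ k : ℕ, sInf {x : ℕ∞ | ∃ k : ℕ, x = k ∧ A k} = k ∧ A k :=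
        csInf_mem h
      obtain ⟨L, hL, hB⟩ := hAB k hAk
      rw [hk]
      calc sInf {x : ℕ∞ | ∃ L : ℕ, x = L ∧ B L} ≤ (L : ℕ∞) := sInf_le ⟨L, rfl, hB⟩
        _ ≤ t * k := by exact_mod_cast hL
  · refine le_sInf ?_
    rintro _ ⟨L, rfl, hB⟩
    obtain ⟨k, hk, hA⟩ := hBA L hB
    calc (t : ℕ∞) * sInf {x : ℕ∞ | ∃ k : ℕ, x = k ∧ A k} ≤ t * k :=
          by gcongr; exact sInf_le ⟨k, rfl, hA⟩
      _ ≤ L := by exact_mod_cast hk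

section Expansion

/-- `Adj'` arises from `Adj` by replacing every edge by a walk of length `t`, where `root` maps a
vertex to the tail of the edges it serves and `depth` is its distance from that tail. -/
structure IsExpansion {V V' : Type*} (Adj : V → V → Prop) (Adj' : V' → V' → Prop) (t : ℕ)
    (ι : V → V') (root : V' → V) (depth : V' → ℕ) : Prop where
  root_ι : ∀ v, root (ι v) = v
  depth_ι : ∀ v, depth (ι v) = 0
  exists_walk : ∀ u v, Adj u v → ∃ w, IsWalk Adj' t w (ι u) (ι v)
  step : ∀ x y, Adj' x y → (depth y = depth x + 1 ∧ root y = root x) ∨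
    (depth x + 1 = t ∧ depth y = 0 ∧ Adj (root x) (root y))

variable {V V' : Type*} {Adj : V → V → Prop} {Adj' : V' → V' → Prop} {t : ℕ}
  {ι : V → V'} {root : V' → V} {depth : V' → ℕ}

theorem IsExpansion.injective (h : IsExpansion Adj Adj' t ι root depth) : Function.Injective ι :=
  Function.LeftInverse.injective h.root_ι

theorem IsExpansion.lift_walk (h : IsExpansion Adj Adj' t ι root depth) {k : ℕ} {w : ℕ → V}
    {u v : V} (hw : IsWalk Adj k w u v) : ∃ w', IsWalk Adj' (t * k) w' (ι u) (ι v) := by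
  induction k generalizing v with
  | zero =>
    obtain ⟨h0, h1, -⟩ := hw
    exact ⟨fun _ => ι u, rfl, by rw [← h0, h1], by simp⟩
  | succ k ih =>
    obtain ⟨h0, h1, hs⟩ := hw
    obtain ⟨w₁, hw₁⟩ := ih ⟨h0, rfl, fun i hi => hs i (by omega)⟩
    obtain ⟨w₂, hw₂⟩ := h.exists_walk _ _ (hs k (by omega))
    rw [h1] at hw₂
    exact ⟨_, hw₁.append hw₂⟩

theorem IsExpansion.project_walk (h : IsExpansion Adj Adj' t ι root depth) {L : ℕ} {w : ℕ → V'}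
    {x y : V'} (hw : IsWalk Adj' L w x y) :
    ∃ k, depth x + L = t * k + depth y ∧ ∃ w', IsWalk Adj k w' (root x) (root y) := by
  induction L generalizing y with
  | zero =>
    obtain ⟨h0, h1, -⟩ := hw
    obtain rfl : x = y := h0.symm.trans h1
    exact ⟨0, by simp, fun _ => root x, rfl, rfl, by simp⟩
  | succ L ih =>
    obtain ⟨h0, h1, hs⟩ := hw
    obtain ⟨k, hk, w₁, hw₁⟩ := ih ⟨h0, rfl, fun i hi => hs i (by omega)⟩
    have hlast := hs L (by omega)
    rw [h1] at hlast
    rcases h.step _ _ hlast with ⟨hd, hr⟩ | ⟨hd, hd', ha⟩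
    · exact ⟨k, by omega, w₁, hr ▸ hw₁⟩
    · refine ⟨k + 1, by rw [Nat.mul_succ]; omega, _, hw₁.append (L := 1)
        (w' := fun i => if i = 0 then root (w L) else root y) ⟨rfl, rfl, ?_⟩⟩
      intro i hi
      obtain rfl : i = 0 := by omega
      simpa using ha

theorem IsExpansion.ddist_eq (h : IsExpansion Adj Adj' t ι root depth) (ht : t ≠ 0) (u v : V) :
    ddist Adj' (ι u) (ι v) = t * ddist Adj u v := by
  refine sInf_natCast_eq_mul ht ?_ ?_
  · rintro k ⟨w, hw⟩
    exact ⟨t * k, le_rfl, h.lift_walk hw⟩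
  · rintro L ⟨w, hw⟩
    obtain ⟨k, hk, hw'⟩ := h.project_walk hw
    simp only [h.root_ι, h.depth_ι] at hk hw'
    exact ⟨k, by omega, hw'⟩

theorem IsExpansion.digirth_eq (h : IsExpansion Adj Adj' t ι root depth) (ht : t ≠ 0) :
    digirth Adj' = t * digirth Adj := by
  refine sInf_natCast_eq_mul ht ?_ ?_
  · rintro k ⟨w, u, hw, hk, -⟩
    obtain ⟨w', hw'⟩ := h.lift_walk hw
    exact hw'.exists_isCycle (Nat.one_le_iff_ne_zero.2 (mul_ne_zero ht (by omega)))
  · rintro L ⟨w, x, hw, hL, -⟩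
    obtain ⟨k, hk, w', hw'⟩ := h.project_walk hw
    have hk0 : 1 ≤ k := by
      rcases Nat.eq_zero_or_pos k with rfl | hk0
      · omega
      · exact hk0
    obtain ⟨K, hK, hc⟩ := hw'.exists_isCycle hk0
    exact ⟨K, (Nat.mul_le_mul_left t hK).trans (by omega), hc⟩

end Expansion

section TreeExpansion

variable {n t q : ℕ} {d : Fin n → ℕ}

/-- The vertices of the digraph obtained by giving each vertex `a` a `q`-ary out-tree of depth `t`
with `d a` leaves: the index of a node counts the nodes of its tree at the same depth. -/
abbrev TreeNode (t q : ℕ) (d : Fin n → ℕ) : Type :=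
  Σ p : Fin n × Fin t, Fin (d p.1 / q ^ (t - p.2) + 1)

/-- Tree edges, where the leaf number `idx a b` of the tree of `a` is identified with the root
of the tree of `b`. -/
def TreeAdj (A : Fin n → Fin n → Prop) (idx : Fin n → Fin n → ℕ) (x y : TreeNode t q d) : Prop :=
  (y.1.1 = x.1.1 ∧ (y.1.2 : ℕ) = x.1.2 + 1 ∧ (y.2 : ℕ) / q = x.2) ∨
  ((x.1.2 : ℕ) + 1 = t ∧ (y.1.2 : ℕ) = 0 ∧ (y.2 : ℕ) = 0 ∧ A x.1.1 y.1.1 ∧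
    idx x.1.1 y.1.1 / q = x.2)

theorem TreeNode.ext' {x y : TreeNode t q d} (h₁ : x.1.1 = y.1.1)
    (h₂ : (x.1.2 : ℕ) = y.1.2) (h₃ : (x.2 : ℕ) = y.2) : x = y := by
  obtain ⟨⟨a, s⟩, j⟩ := x
  obtain ⟨⟨b, s'⟩, j'⟩ := y
  obtain rfl : a = b := h₁
  obtain rfl : s = s' := Fin.ext h₂
  obtain rfl : j = j' := Fin.ext h₃
  rfl

theorem ncard_treeAdj_le {A : Fin n → Fin n → Prop} {idx : Fin n → Fin n → ℕ} (hq : 0 < q)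
    (hinj : ∀ a, Set.InjOn (idx a) {b | A a b}) (x : TreeNode t q d) :
    {y | TreeAdj A idx x y}.ncard ≤ q := by
  have hcard : (Set.Ico ((x.2 : ℕ) * q) (x.2 * q + q)).ncard = q := by
    rw [← Finset.coe_Ico, Set.ncard_coe_finset, Nat.card_Ico]
    omega
  have hmem {i : ℕ} (h : i / q = x.2) : i ∈ Set.Ico ((x.2 : ℕ) * q) (x.2 * q + q) := by
    rw [← h]
    exact ⟨Nat.div_mul_le_self i q, Nat.lt_div_mul_add hq⟩
  have hlt (y : TreeNode t q d) : (y.1.2 : ℕ) < t := y.1.2.2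
  refine le_of_le_of_eq ?_ hcard
  by_cases ht : (x.1.2 : ℕ) + 1 = t
  · have key : ∀ y, TreeAdj A idx x y → (y.1.2 : ℕ) = 0 ∧ (y.2 : ℕ) = 0 ∧ A x.1.1 y.1.1 ∧
        idx x.1.1 y.1.1 / q = x.2 := by
      rintro y (⟨-, h, -⟩ | ⟨-, h⟩)
      · have := hlt y
        omega
      · exact h
    refine Set.ncard_le_ncard_of_injOn (fun y => idx x.1.1 y.1.1)
      (fun y hy => hmem (key y hy).2.2.2) ?_ (Set.finite_Ico _ _)
    intro y hy z hz hyz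
    obtain ⟨hy1, hy2, hy3, -⟩ := key y hy
    obtain ⟨hz1, hz2, hz3, -⟩ := key z hz
    exact TreeNode.ext' (hinj _ hy3 hz3 hyz) (hy1.trans hz1.symm) (hy2.trans hz2.symm)
  · have key : ∀ y, TreeAdj A idx x y → y.1.1 = x.1.1 ∧ (y.1.2 : ℕ) = x.1.2 + 1 ∧
        (y.2 : ℕ) / q = x.2 := by
      rintro y (h | ⟨h, -⟩)
      · exact h
      · exact absurd h ht
    refine Set.ncard_le_ncard_of_injOn (fun y => (y.2 : ℕ))
      (fun y hy => hmem (key y hy).2.2) ?_ (Set.finite_Ico _ _)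
    intro y hy z hz hyz
    obtain ⟨hy1, hy2, -⟩ := key y hy
    obtain ⟨hz1, hz2, -⟩ := key z hz
    exact TreeNode.ext' (hy1.trans hz1.symm) (hy2.trans hz2.symm) hyz

theorem isExpansion_treeAdj {A : Fin n → Fin n → Prop} {idx : Fin n → Fin n → ℕ} (ht : 0 < t)
    (hidx : ∀ a b, A a b → idx a b < d a) (hd : ∀ a, d a ≤ q ^ t) :
    IsExpansion A (TreeAdj A idx) t (fun a => (⟨(a, ⟨0, ht⟩), 0⟩ : TreeNode t q d))
      (fun x => x.1.1) (fun x => x.1.2) where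
  root_ι _ := rfl
  depth_ι _ := rfl
  step := by
    rintro x y (⟨h₁, h₂, -⟩ | ⟨h₁, h₂, -, h₃, -⟩)
    · exact Or.inl ⟨h₂, h₁⟩
    · exact Or.inr ⟨h₁, h₂, h₃⟩
  exists_walk u v huv := by
    have hi := hidx u v huv
    have hlt (s : ℕ) : idx u v / q ^ (t - s) < d u / q ^ (t - s) + 1 :=
      Nat.lt_succ_of_le (Nat.div_le_div_right hi.le)
    obtain ⟨w, hw, hwt⟩ : ∃ w : ℕ → TreeNode t q d,
        (∀ s (hs : s < t), w s = ⟨(u, ⟨s, hs⟩), ⟨idx u v / q ^ (t - s), hlt s⟩⟩) ∧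
        w t = ⟨(v, ⟨0, ht⟩), 0⟩ :=
      ⟨fun s => if hs : s < t then ⟨(u, ⟨s, hs⟩), ⟨idx u v / q ^ (t - s), hlt s⟩⟩
        else ⟨(v, ⟨0, ht⟩), 0⟩, fun s hs => dif_pos hs, dif_neg (lt_irrefl t)⟩
    refine ⟨w, ?_, hwt, fun s hs => ?_⟩
    · rw [hw 0 ht]
      exact TreeNode.ext' rfl rfl (Nat.div_eq_of_lt (hi.trans_le (hd u)))
    · rcases Nat.lt_or_eq_of_le (Nat.succ_le_of_lt hs) with hs' | hs'
      · rw [hw s hs, hw (s + 1) hs']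
        refine Or.inl ⟨rfl, rfl, ?_⟩
        dsimp only
        rw [Nat.div_div_eq_div_mul, ← pow_succ, show t - (s + 1) + 1 = t - s by omega]
      · have hnext : w (s + 1) = ⟨(v, ⟨0, ht⟩), 0⟩ := hs' ▸ hwt
        rw [hw s hs, hnext]
        refine Or.inr ⟨hs', rfl, rfl, huv, ?_⟩
        dsimp only
        rw [show t - s = 1 by omega, pow_one]

theorem card_treeNode_le (hq : 2 ≤ q) (hsum : ∑ a, d a ≤ n * q) :
    Fintype.card (TreeNode t q d) ≤ n * (t + 2) := by
  have hrow (a : Fin n) : ∑ s : Fin t, (d a / q ^ (t - s) + 1) ≤ d a / (q - 1) + t := by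
    rw [Finset.sum_add_distrib]
    refine Nat.add_le_add ?_ (by simp)
    rw [Fin.sum_univ_eq_sum_range (fun s => d a / q ^ (t - s)), ← Finset.sum_range_reflect]
    calc _ = ∑ i ∈ Finset.Ico 1 (t + 1), d a / q ^ i := by
          rw [Finset.sum_Ico_eq_sum_range]
          refine Finset.sum_congr (by simp) fun i hi => ?_
          rw [Finset.mem_range] at hi
          congr 2
          omega
      _ ≤ _ := Nat.geom_sum_Ico_le hq _ _
  have hdiv : ∑ a, d a / (q - 1) ≤ 2 * n := by
    refine Nat.le_of_mul_le_mul_left (c := q - 1) ?_ (by omega)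
    calc (q - 1) * ∑ a, d a / (q - 1) ≤ ∑ a, d a := by
          rw [Finset.mul_sum]
          exact Finset.sum_le_sum fun a _ => Nat.mul_div_le _ _
      _ ≤ n * q := hsum
      _ ≤ n * (2 * (q - 1)) := Nat.mul_le_mul_left n (by omega)
      _ = (q - 1) * (2 * n) := by ring
  calc Fintype.card (TreeNode t q d)
      = ∑ a : Fin n, ∑ s : Fin t, (d a / q ^ (t - s) + 1) := by
        simp [Fintype.card_sigma, Fintype.sum_prod_type]
    _ ≤ ∑ a : Fin n, (d a / (q - 1) + t) := Finset.sum_le_sum fun a _ => hrow a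
    _ ≤ 2 * n + n * t := by
        rw [Finset.sum_add_distrib]
        exact Nat.add_le_add hdiv (by simp)
    _ = n * (t + 2) := by ring

end TreeExpansion

/-- The elements of a finite set can be numbered by the naturals below its cardinality. -/
theorem Set.Finite.exists_injOn_lt_ncard {α : Type*} {s : Set α} (hs : s.Finite) :
    ∃ f : α → ℕ, Set.InjOn f s ∧ ∀ x ∈ s, f x < s.ncard := by
  classical
  have := hs.fintype
  have e : s ≃ Fin s.ncard := Fintype.equivFinOfCardEq (Set.fintypeCard_eq_ncard s)
  refine ⟨fun x => if hx : x ∈ s then e ⟨x, hx⟩ else 0, ?_, fun x hx => by simp [hx]⟩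
  intro x hx y hy hxy
  simpa [hx, hy, Fin.val_inj] using hxy

theorem sum_ncard_eq_ncard_rel {α : Type*} [Fintype α] (A : α → α → Prop) :
    ∑ a, {b | A a b}.ncard = {p : α × α | A p.1 p.2}.ncard := by
  classical
  simp only [← Nat.card_coe_set_eq, Set.coe_ofPred]
  rw [← Nat.card_sigma]
  exact Nat.card_congr
    ⟨fun x => ⟨(x.1, x.2.1), x.2.2⟩, fun x => ⟨x.1.1, x.1.2, x.2⟩, fun _ => rfl, fun _ => rfl⟩

theorem stmt_5 {V : Type*} [Fintype V] (Adj : V → V → Prop) (n m : ℕ)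
    (hn : n = Fintype.card V) (hn2 : 2 ≤ n)
    (hm : m = {p : V × V | Adj p.1 p.2}.ncard) (hm1 : 1 ≤ m)
    (q t : ℕ) (hq : q = max 2 ((m + n - 1) / n)) (ht : t = Nat.clog q n) :
    ∃ (V' : Type) (_ : Fintype V') (Adj' : V' → V' → Prop) (ι : V → V'),
      Function.Injective ι ∧
      Fintype.card V' ≤ n * (Nat.clog 2 n + 7) ∧
      (∀ u' : V', {v' : V' | Adj' u' v'}.ncard ≤ q) ∧
      (∀ u v : V, ddist Adj' (ι u) (ι v) = (t : ℕ∞) * ddist Adj u v) ∧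
      digirth Adj' = (t : ℕ∞) * digirth Adj := by
  have hq2 : 2 ≤ q := hq ▸ le_max_left _ _
  have ht0 : 0 < t := ht ▸ Nat.clog_pos hq2 hn2
  have hmq : m ≤ n * q := by
    have h : (m + n - 1) / n ≤ q := hq ▸ le_max_right _ _
    have h' := (Nat.div_lt_iff_lt_mul (by omega)).1 (Nat.lt_succ_of_le h)
    rw [Nat.succ_mul, Nat.mul_comm] at h'
    omega
  have htn : n ≤ q ^ t := ht ▸ Nat.le_pow_clog hq2 n
  let e : V ≃ Fin n := Fintype.equivFinOfCardEq hn.symm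
  let A : Fin n → Fin n → Prop := fun a b => Adj (e.symm a) (e.symm b)
  let d : Fin n → ℕ := fun a => {b | A a b}.ncard
  choose idx hinj hidx using fun a => (Set.toFinite {b | A a b}).exists_injOn_lt_ncard
  have hd (a : Fin n) : d a ≤ q ^ t :=
    ((Set.ncard_le_card _).trans_eq (by simp)).trans htn
  have hsum : ∑ a, d a ≤ n * q := by
    refine (le_of_eq ?_).trans (hm ▸ hmq)
    rw [sum_ncard_eq_ncard_rel]
    exact Nat.card_congr ((Equiv.prodCongr e.symm e.symm).subtypeEquiv fun _ => Iff.rfl)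
  have hexp := isExpansion_treeAdj (A := A) (d := d) ht0 hidx hd
  have hexp' : IsExpansion Adj (TreeAdj A idx) t
      (fun v => (⟨(e v, ⟨0, ht0⟩), 0⟩ : TreeNode t q d)) (fun x => e.symm x.1.1)
      (fun x => x.1.2) :=
    { root_ι := by simp
      depth_ι := by simp
      exists_walk := fun u v huv => hexp.exists_walk _ _ (by simpa [A] using huv)
      step := fun x y hxy =>
        (hexp.step x y hxy).imp_left fun h => ⟨h.1, congrArg e.symm h.2⟩ }
  refine ⟨TreeNode t q d, inferInstance, TreeAdj A idx, _,
    hexp'.injective, ?_, ncard_treeAdj_le (by omega) hinj,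
    hexp'.ddist_eq ht0.ne', hexp'.digirth_eq ht0.ne'⟩
  refine (card_treeNode_le hq2 hsum).trans (Nat.mul_le_mul_left n ?_)
  have : t ≤ Nat.clog 2 n := ht ▸ Nat.clog_anti_left (by omega) hq2
  omega
end

section
/- Let G be a directed graph, let u be a vertex of G, and let C = (u = c_0, c_1, …, c_{L-1}, c_L = u) be a cycle of minimum length L among all cycles of G that contain u. Then for every j with 0 ≤ j < L, the distance from u to c_j in G equals j, i.e. d(u, c_j) = j. -/
theorem IsWalk.append_s8 {V : Type*} {Adj : V → V → Prop} {m n : ℕ} {p q : ℕ → V} {u v w : V}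
    (hp : IsWalk Adj m p u v) (hq : IsWalk Adj n q v w) :
    IsWalk Adj (m + n) (fun k => if k ≤ m then p k else q (k - m)) u w := by
  obtain ⟨hp0, hpm, hp⟩ := hp
  obtain ⟨hq0, hqn, hq⟩ := hq
  refine ⟨by simpa using hp0, ?_, fun k hk => ?_⟩
  · rcases Nat.eq_zero_or_pos n with rfl | hn
    · simp [hpm, ← hqn, hq0]
    · simp [hqn, hn.ne']
  · rcases lt_trichotomy k m with h | rfl | h
    · simpa [h.le, Nat.succ_le_of_lt h] using hp k h
    · simpa [hpm, hq0] using hq 0 (by lia)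
    · have := hq (k - m) (by lia)
      rw [← Nat.sub_add_comm h.le] at this
      simpa [h.not_ge, show ¬ k + 1 ≤ m by lia] using this

theorem IsWalk.take {V : Type*} {Adj : V → V → Prop} {n : ℕ} {p : ℕ → V} {u v : V}
    (hp : IsWalk Adj n p u v) {i : ℕ} (hi : i ≤ n) : IsWalk Adj i p u (p i) :=
  ⟨hp.1, rfl, fun k hk => hp.2.2 k (by lia)⟩

theorem IsWalk.drop {V : Type*} {Adj : V → V → Prop} {n : ℕ} {p : ℕ → V} {u v : V}
    (hp : IsWalk Adj n p u v) {i : ℕ} (hi : i ≤ n) :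
    IsWalk Adj (n - i) (fun k => p (i + k)) (p i) v :=
  ⟨rfl, by simpa [Nat.add_sub_cancel' hi] using hp.2.1,
    fun k hk => hp.2.2 (i + k) (by lia)⟩

/-- A closed walk of positive length at `u` yields a cycle based at `u` that is no longer. -/
theorem IsWalk.exists_isCycle_le {V : Type*} {Adj : V → V → Prop} {u : V} {n : ℕ} {p : ℕ → V}
    (hp : IsWalk Adj n p u u) (hn : 1 ≤ n) : ∃ m ≤ n, ∃ c : ℕ → V, IsCycle Adj m c u := by
  induction n using Nat.strong_induction_on generalizing p with
  | _ n ih =>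
    by_cases hinj : ∀ i < n, ∀ j < n, p i = p j → i = j
    · exact ⟨n, le_rfl, p, hp, hn, hinj⟩
    · obtain ⟨i, j, hij, hj, h⟩ : ∃ i j, i < j ∧ j < n ∧ p i = p j := by
        push Not at hinj
        obtain ⟨i, hi, j, hj, h, hne⟩ := hinj
        rcases hne.lt_or_gt with hlt | hlt
        · exact ⟨i, j, hlt, hj, h⟩
        · exact ⟨j, i, hlt, hi, h.symm⟩
      have hshort := (h ▸ hp.take (hij.trans hj).le).append_s8 (hp.drop hj.le)
      obtain ⟨m, hm, c, hc⟩ := ih (i + (n - j)) (by lia) hshort (by lia)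
      exact ⟨m, by lia, c, hc⟩

theorem stmt_8 {V : Type*} (Adj : V → V → Prop) (u : V) (L : ℕ) (c : ℕ → V)
    (hC : IsCycle Adj L c u)
    (hmin : ∀ (L' : ℕ) (c' : ℕ → V) (u' : V),
      IsCycle Adj L' c' u' → (∃ i < L', c' i = u) → L ≤ L') :
    ∀ j < L, ddist Adj u (c j) = (j : ℕ∞) := by
  intro j hj
  apply le_antisymm
  · exact sInf_le ⟨j, rfl, c, hC.1.take hj.le⟩
  · refine le_sInf ?_
    rintro _ ⟨m, rfl, w, hw⟩
    obtain ⟨n, hn, c', hc'⟩ :=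
      (hw.append_s8 (hC.1.drop hj.le)).exists_isCycle_le (by lia)
    have := hmin n c' u hc' ⟨0, hc'.2.1, hc'.1.1⟩
    exact_mod_cast (show j ≤ m by lia)
end

section
/- Let G be a directed graph without self-loops (its adjacency relation is irreflexive) whose girth g is finite, and let s be a vertex lying on some cycle of length g. Then g equals the minimum over all vertices v ≠ s of d(s,v) + d(v,s), where d denotes directed distance in ℕ∞. -/
section Walks

variable {V : Type*} {Adj : V → V → Prop}

theorem IsWalk.segment {L : ℕ} {w : ℕ → V} {u v : V} (h : IsWalk Adj L w u v) {i j : ℕ}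
    (hij : i ≤ j) (hj : j ≤ L) : IsWalk Adj (j - i) (fun k => w (i + k)) (w i) (w j) := by
  refine ⟨rfl, ?_, fun k hk => h.2.2 (i + k) (by omega)⟩
  simp only [Nat.add_sub_cancel' hij]

theorem IsWalk.append_s9 {a b : ℕ} {w₁ w₂ : ℕ → V} {u v t : V} (h₁ : IsWalk Adj a w₁ u v)
    (h₂ : IsWalk Adj b w₂ v t) :
    IsWalk Adj (a + b) (fun k => if k ≤ a then w₁ k else w₂ (k - a)) u t := by
  obtain ⟨h0, ha, hadj₁⟩ := h₁
  obtain ⟨h0', hb, hadj₂⟩ := h₂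
  refine ⟨by simpa using h0, ?_, fun k hk => ?_⟩
  · rcases Nat.eq_zero_or_pos b with rfl | hpos
    · simp [ha, ← hb, h0']
    · simp [hb, hpos.ne']
  · rcases lt_trichotomy k a with hka | rfl | hka
    · simpa [hka.le, Nat.succ_le_of_lt hka] using hadj₁ k hka
    · simpa [ha, h0'] using hadj₂ 0 (by omega)
    · have := hadj₂ (k - a) (by omega)
      simpa [show ¬ k ≤ a by omega, show ¬ k + 1 ≤ a by omega,
        show k + 1 - a = k - a + 1 by omega] using this

theorem IsWalk.ddist_le {L : ℕ} {w : ℕ → V} {u v : V} (h : IsWalk Adj L w u v) :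
    ddist Adj u v ≤ L :=
  sInf_le ⟨L, rfl, w, h⟩

theorem exists_isWalk_of_ddist_ne_top {u v : V} (h : ddist Adj u v ≠ ⊤) :
    ∃ (L : ℕ) (w : ℕ → V), ddist Adj u v = L ∧ IsWalk Adj L w u v := by
  have hne : {x : ℕ∞ | ∃ L : ℕ, x = L ∧ ∃ w : ℕ → V, IsWalk Adj L w u v}.Nonempty := by
    by_contra hempty
    rw [Set.not_nonempty_iff_eq_empty] at hempty
    exact h (by rw [ddist, hempty, sInf_empty])
  obtain ⟨L, hL, w, hw⟩ := csInf_mem hne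
  exact ⟨L, w, hL, hw⟩

theorem IsWalk.digirth_le {L : ℕ} {w : ℕ → V} {u : V} (h : IsWalk Adj L w u u) (hL : 1 ≤ L) :
    digirth Adj ≤ L := by
  induction L using Nat.strong_induction_on generalizing w u with
  | _ L ih =>
    by_cases hinj : ∀ i < L, ∀ j < L, w i = w j → i = j
    · exact sInf_le ⟨L, rfl, w, u, h, hL, hinj⟩
    · have hrep : ∃ i j, i < j ∧ j < L ∧ w i = w j := by
        push Not at hinj
        obtain ⟨i, hi, j, hj, hw, hne⟩ := hinj
        rcases lt_or_gt_of_ne hne with hlt | hlt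
        · exact ⟨i, j, hlt, hj, hw⟩
        · exact ⟨j, i, hlt, hi, hw.symm⟩
      obtain ⟨i, j, hij, hj, hw⟩ := hrep
      have hseg := h.segment hij.le hj.le
      rw [← hw] at hseg
      exact (ih (j - i) (by omega) hseg (by omega)).trans
        (Nat.cast_le.mpr (by omega))

theorem digirth_le_ddist_add_ddist {s v : V} (hv : v ≠ s) :
    digirth Adj ≤ ddist Adj s v + ddist Adj v s := by
  by_cases h₁ : ddist Adj s v = ⊤
  · simp [h₁]
  by_cases h₂ : ddist Adj v s = ⊤
  · simp [h₂]
  obtain ⟨a, w₁, ha, hw₁⟩ := exists_isWalk_of_ddist_ne_top h₁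
  obtain ⟨b, w₂, hb, hw₂⟩ := exists_isWalk_of_ddist_ne_top h₂
  have hpos : 1 ≤ a := by
    by_contra ha0
    obtain rfl : a = 0 := by omega
    exact hv (hw₁.2.1.symm.trans hw₁.1)
  rw [ha, hb, ← Nat.cast_add]
  exact (hw₁.append_s9 hw₂).digirth_le (by omega)

theorem IsWalk.ddist_add_ddist_le {L : ℕ} {w : ℕ → V} {u : V} (h : IsWalk Adj L w u u)
    {i j : ℕ} (hij : i ≤ j) (hj : j ≤ L) :
    ddist Adj (w i) (w j) + ddist Adj (w j) (w i) ≤ L := by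
  have hend := h.segment hj le_rfl
  have hstart := h.segment (Nat.zero_le i) (hij.trans hj)
  rw [h.2.1] at hend
  rw [h.1] at hstart
  refine (add_le_add (h.segment hij hj).ddist_le (hend.append_s9 hstart).ddist_le).trans ?_
  rw [← Nat.cast_add]
  exact Nat.cast_le.mpr (by omega)

end Walks

theorem stmt_9 {V : Type*} (Adj : V → V → Prop) (hirr : ∀ v : V, ¬ Adj v v)
    (g : ℕ) (hg : digirth Adj = (g : ℕ∞)) (s : V)
    (hs : ∃ (c : ℕ → V) (u : V), IsCycle Adj g c u ∧ ∃ i < g, c i = s) :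
    digirth Adj = sInf {x : ℕ∞ | ∃ v : V, v ≠ s ∧ x = ddist Adj s v + ddist Adj v s} := by
  apply le_antisymm
  · apply le_sInf
    rintro _ ⟨v, hv, rfl⟩
    exact digirth_le_ddist_add_ddist hv
  · obtain ⟨c, u, ⟨hwalk, hpos, hinj⟩, i, hi, rfl⟩ := hs
    have hg2 : 2 ≤ g := by
      by_contra hlt
      obtain rfl : g = 1 := by omega
      have hadj := hwalk.2.2 0 one_pos
      rw [zero_add, hwalk.1, hwalk.2.1] at hadj
      exact hirr u hadj
    rw [hg]
    rcases Nat.eq_zero_or_pos i with rfl | hi0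
    · exact sInf_le_of_le ⟨c 1, fun h => one_ne_zero (hinj 1 (by omega) 0 hi h), rfl⟩
        (hwalk.ddist_add_ddist_le zero_le_one hpos)
    · refine sInf_le_of_le ⟨c 0, fun h => hi0.ne (hinj 0 (by omega) i hi h), rfl⟩ ?_
      rw [add_comm]
      exact hwalk.ddist_add_ddist_le hi0.le hi.le
end

section
/- Let d be a quasimetric on a set V, let ε ≥ 0 be real, and let i, j be integers with j ≤ i. Let u, v, x, y ∈ V satisfy (1+ε)^i ≤ d(u,v) + d(v,u) < (1+ε)^{i+1}, d(u,x) + d(x,v) = d(u,v) (i.e. x lies on a shortest path from u to v), (1+ε)^j ≤ d(u,x), and d(u,y) < (1+ε)^{j+1}. Then d(x,y) ≤ (1+ε)^{i+2}. -/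
theorem stmt_13 {V : Type*} (d : V → V → ℝ)
    (hnonneg : ∀ x y : V, 0 ≤ d x y) (hrefl : ∀ x : V, d x x = 0)
    (htri : ∀ x y z : V, d x z ≤ d x y + d y z)
    (ε : ℝ) (hε : 0 ≤ ε) (i j : ℤ) (hji : j ≤ i) (u v x y : V)
    (h1 : (1 + ε) ^ i ≤ d u v + d v u) (h2 : d u v + d v u < (1 + ε) ^ (i + 1))
    (hx : d u x + d x v = d u v)
    (h3 : (1 + ε) ^ j ≤ d u x) (h4 : d u y < (1 + ε) ^ (j + 1)) :
    d x y ≤ (1 + ε) ^ (i + 2) := by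
  have ha : (1 + ε) ≠ 0 := by positivity
  have hpow : (1 + ε) ^ j ≤ (1 + ε) ^ (i + 1) :=
    zpow_le_zpow_right₀ (by linarith) (by linarith)
  have hj : (1 + ε) ^ (j + 1) = (1 + ε) ^ j * (1 + ε) := zpow_add_one₀ ha j
  have hi : (1 + ε) ^ (i + 2) = (1 + ε) ^ (i + 1) * (1 + ε) := by
    rw [← zpow_add_one₀ ha, add_assoc, one_add_one_eq_two]
  have hmul := mul_le_mul_of_nonneg_left hpow hε
  linarith [htri x v y, htri v u y]
end

section
/- Let ε > 0, K ≥ 0, g > 0, W > 0, g' ≥ 0 be real numbers and n ≥ 1 an integer, with W ≤ g; set R = W·ε/n. Let p ≤ n be a natural number and let w_1, …, w_p be positive reals with R·g' ≤ g and Σ_{e=1}^p ⌊w_e/R⌋ ≤ K·g'. Then Σ_{e=1}^p w_e ≤ (K + ε)·g. -/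
theorem stmt_15 (ε K g W g' : ℝ) (n : ℕ)
    (hε : 0 < ε) (hK : 0 ≤ K) (hg : 0 < g) (hW : 0 < W) (hg' : 0 ≤ g')
    (hn : 1 ≤ n) (hWg : W ≤ g)
    (R : ℝ) (hR : R = W * ε / n)
    (p : ℕ) (hp : p ≤ n) (w : ℕ → ℝ) (hw : ∀ e < p, 0 < w e)
    (hRg' : R * g' ≤ g)
    (hsum : ∑ e ∈ Finset.range p, (⌊w e / R⌋ : ℝ) ≤ K * g') :
    ∑ e ∈ Finset.range p, w e ≤ (K + ε) * g := by
  have hn0 : (0 : ℝ) < n := by exact_mod_cast hn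
  have hR0 : 0 < R := by rw [hR]; positivity
  have hnR : n * R = W * ε := by rw [hR]; field_simp
  have hpn : (p : ℝ) ≤ n := by exact_mod_cast hp
  have hle (e : ℕ) : w e ≤ R * (⌊w e / R⌋ : ℝ) + R := by
    have h := (div_lt_iff₀ hR0).mp (Int.lt_floor_add_one (w e / R))
    linarith
  calc ∑ e ∈ Finset.range p, w e
      ≤ ∑ e ∈ Finset.range p, (R * (⌊w e / R⌋ : ℝ) + R) :=
        Finset.sum_le_sum fun e _ => hle e
    _ = R * ∑ e ∈ Finset.range p, (⌊w e / R⌋ : ℝ) + p * R := by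
        simp [Finset.sum_add_distrib, Finset.mul_sum]
    _ ≤ R * (K * g') + n * R := by gcongr
    _ = K * (R * g') + W * ε := by rw [hnR]; ring
    _ ≤ K * g + g * ε := by gcongr
    _ = (K + ε) * g := by ring
end

section
/- Let k ≥ 2 be an integer, C ≥ 1 and n ≥ 1 real numbers, and α a real number with 0 < α < 1 satisfying α·(1+α)^{k-1} = 1 − α. Let s_1 ≤ s_2 ≤ … ≤ s_k be real numbers with s_1 ≥ n^α and s_k ≤ C·n^{1−α}. Then there exists an index l with 1 ≤ l ≤ k−1 such that s_{l+1} ≤ C·(s_l · n^α)^{1/(1+α)}. -/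
/-- If `a` lies above `n ^ (1 - d)`, then the mean `(a * n ^ α) ^ (1 / (1 + α))` lies above
`n ^ (1 - d / (1 + α))`: the gap of the exponent to `1` shrinks by the factor `1 + α`. -/
theorem rpow_one_sub_div_le_mul_rpow {n α d a : ℝ} (hn : 0 < n) (hα : 0 < α)
    (ha : n ^ (1 - d) ≤ a) :
    n ^ (1 - d / (1 + α)) ≤ (a * n ^ α) ^ (1 / (1 + α)) := by
  have hexp : 1 - d / (1 + α) = (1 - d + α) * (1 / (1 + α)) := by
    field_simp
    ring
  rw [hexp, Real.rpow_mul hn.le, Real.rpow_add hn]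
  gcongr

theorem stmt_16 (k : ℕ) (hk : 2 ≤ k) (C n : ℝ) (hC : 1 ≤ C) (hn : 1 ≤ n)
    (α : ℝ) (hα0 : 0 < α) (hα1 : α < 1)
    (hαeq : α * (1 + α) ^ (k - 1) = 1 - α)
    (s : ℕ → ℝ) (hmono : ∀ l, 1 ≤ l → l < k → s l ≤ s (l + 1))
    (hs1 : n ^ α ≤ s 1) (hsk : s k ≤ C * n ^ (1 - α)) :
    ∃ l, 1 ≤ l ∧ l ≤ k - 1 ∧ s (l + 1) ≤ C * (s l * n ^ α) ^ (1 / (1 + α)) := by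
  by_contra! h
  have hn0 : 0 < n := by linarith
  have step : ∀ j, j + 1 ≤ k - 1 → n ^ (1 - (1 - α) / (1 + α) ^ j) ≤ s (j + 1) →
      C * n ^ (1 - (1 - α) / (1 + α) ^ (j + 1)) < s (j + 2) := by
    intro j hj hle
    refine lt_of_le_of_lt ?_ (h (j + 1) (by omega) hj)
    rw [pow_succ, ← div_div]
    gcongr
    exact rpow_one_sub_div_le_mul_rpow hn0 hα0 hle
  have lower : ∀ j, j + 1 ≤ k - 1 → n ^ (1 - (1 - α) / (1 + α) ^ j) ≤ s (j + 1) := by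
    intro j
    induction j with
    | zero => simpa using fun _ => hs1
    | succ j ih =>
      intro hj
      exact (le_mul_of_one_le_left (by positivity) hC).trans
        (step j (by omega) (ih (by omega))).le
  obtain ⟨m, rfl⟩ := Nat.exists_eq_add_of_le' hk
  have hlast := step m (by omega) (lower m (by omega))
  have hα : (1 - α) / (1 + α) ^ (m + 1) = α := by
    rw [← hαeq]
    exact mul_div_cancel_right₀ α (by positivity)
  rw [hα] at hlast
  exact hlast.not_ge hsk
end

section
/- Let d be a quasimetric on a set V, let ε ≥ 0 and g' > 0 be reals, let l ≥ 1 be an integer, and let j₁, j₂, j₃ be natural numbers. Let u, v, w, r ∈ V satisfy: (1+ε)^{j₁} ≤ d(u,v) < (1+ε)^{j₁+1}; (1+ε)^{j₂} ≤ d(u,w); d(v,w) + d(w,v) ≤ g'; (1+ε)^{j₁} ≤ (l−1)·g'; and d(v,r) ≤ ((l−1) + (l−1)²·ε)·g' + (1+ε)^{j₃+1} − (1+ε)^{j₁}. Then d(w,r) ≤ (l + l²·ε)·g' + (1+ε)^{j₃+1} − (1+ε)^{j₂}. -/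
theorem stmt_18 {V : Type*} (d : V → V → ℝ)
    (hnonneg : ∀ x y : V, 0 ≤ d x y) (hrefl : ∀ x : V, d x x = 0)
    (htri : ∀ x y z : V, d x z ≤ d x y + d y z)
    (ε g' : ℝ) (hε : 0 ≤ ε) (hg' : 0 < g')
    (l : ℕ) (hl : 1 ≤ l) (j₁ j₂ j₃ : ℕ) (u v w r : V)
    (h1 : (1 + ε) ^ j₁ ≤ d u v) (h2 : d u v < (1 + ε) ^ (j₁ + 1))
    (h3 : (1 + ε) ^ j₂ ≤ d u w)
    (h4 : d v w + d w v ≤ g')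
    (h5 : (1 + ε) ^ j₁ ≤ ((l : ℝ) - 1) * g')
    (h6 : d v r ≤ (((l : ℝ) - 1) + ((l : ℝ) - 1) ^ 2 * ε) * g'
        + (1 + ε) ^ (j₃ + 1) - (1 + ε) ^ j₁) :
    d w r ≤ ((l : ℝ) + (l : ℝ) ^ 2 * ε) * g' + (1 + ε) ^ (j₃ + 1) - (1 + ε) ^ j₂ := by
  have huw := htri u v w
  have hwr := htri w v r
  have hmul := mul_le_mul_of_nonneg_left h5 hε
  have hpos : 0 ≤ (l : ℝ) * ε * g' := by positivity
  rw [pow_succ] at h2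
  linarith
end

section
/- Let d be a quasimetric on a set V, let ε ≥ 0 and g' > 0 be reals, and let j, j' be natural numbers. Let u, v, w, r ∈ V satisfy: (1+ε)^j ≤ d(u,v) < (1+ε)^{j+1}; (1+ε)^j ≤ g'/2; (1+ε)^{j'} ≤ d(u,w); (1+ε)^{j'} ≤ 3g'/2; d(v,w) + d(w,v) ≤ g'; and d(v,r) ≤ g' − (1+ε)^j + (1+ε)^{j'+1}. Then d(w,r) ≤ 2(1+ε)·g'. -/
theorem stmt_19 {V : Type*} (d : V → V → ℝ)
    (hnonneg : ∀ x y : V, 0 ≤ d x y) (hrefl : ∀ x : V, d x x = 0)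
    (htri : ∀ x y z : V, d x z ≤ d x y + d y z)
    (ε g' : ℝ) (hε : 0 ≤ ε) (hg' : 0 < g')
    (j j' : ℕ) (u v w r : V)
    (h1 : (1 + ε) ^ j ≤ d u v) (h2 : d u v < (1 + ε) ^ (j + 1))
    (h3 : (1 + ε) ^ j ≤ g' / 2)
    (h4 : (1 + ε) ^ j' ≤ d u w)
    (h5 : (1 + ε) ^ j' ≤ 3 * g' / 2)
    (h6 : d v w + d w v ≤ g')
    (h7 : d v r ≤ g' - (1 + ε) ^ j + (1 + ε) ^ (j' + 1)) :
    d w r ≤ 2 * (1 + ε) * g' := by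
  have huw := htri u v w
  have hwr := htri w v r
  rw [pow_succ] at h2 h7
  have hsum : ε * ((1 + ε) ^ j + (1 + ε) ^ j') ≤ ε * (2 * g') :=
    mul_le_mul_of_nonneg_left (by linarith) hε
  linarith
end
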